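/- arXiv:math/0503674 — 2 statements merged into one kernel-verified Lean document; each statement's English description precedes it below -/
import Mathlib

section
/- Let f be a nonnegative integrable function on [0, 1], let k ≥ 0 and 0 ≤ ℓ < 2^k be integers, and suppose f_{k,ℓ} := 2^k·∫_{I_{k,ℓ}} f > 0. Let φ_{k,ℓ} = 2^{k/2}·(1_{I_{k+1,2ℓ}} − 1_{I_{k+1,2ℓ+1}}) be the Haar basis function and θ_{k,ℓ} = ∫ f·φ_{k,ℓ} the Haar coefficient of f. Then |∫ √f·φ_{k,ℓ} − θ_{k,ℓ}/(2√(f_{k,ℓ}))| ≤ 2^{k/2 − 1}·f_{k,ℓ}^{−3/2}·∫_{I_{k,ℓ}} (f − f_{k,ℓ})². -/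
open MeasureTheory

/-- The dyadic interval `I_{k,ℓ} = [ℓ/2^k, (ℓ+1)/2^k)`. -/
noncomputable def dyadicI (k ℓ : ℕ) : Set ℝ :=
  Set.Ico ((ℓ : ℝ) / 2 ^ k) (((ℓ : ℝ) + 1) / 2 ^ k)

/-- The local average `f_{k,ℓ} = 2^k ∫_{I_{k,ℓ}} f`. -/
noncomputable def dyadicAvg (f : ℝ → ℝ) (k ℓ : ℕ) : ℝ :=
  2 ^ k * ∫ x in dyadicI k ℓ, f x

/-- The Haar basis function `φ_{k,ℓ} = 2^{k/2} (1_{I_{k+1,2ℓ}} − 1_{I_{k+1,2ℓ+1}})`. -/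
noncomputable def haarFn (k ℓ : ℕ) (x : ℝ) : ℝ :=
  (2 : ℝ) ^ ((k : ℝ) / 2) *
    (Set.indicator (dyadicI (k + 1) (2 * ℓ)) (fun _ => (1 : ℝ)) x -
      Set.indicator (dyadicI (k + 1) (2 * ℓ + 1)) (fun _ => (1 : ℝ)) x)

/-- The Haar coefficient `θ_{k,ℓ} = ∫ f φ_{k,ℓ}`. -/
noncomputable def haarCoeff (f : ℝ → ℝ) (k ℓ : ℕ) : ℝ :=
  ∫ x in Set.Ico (0 : ℝ) 1, f x * haarFn k ℓ x

theorem measurableSet_dyadicI (k ℓ : ℕ) : MeasurableSet (dyadicI k ℓ) := measurableSet_Ico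

theorem dyadicI_succ_left_subset (k ℓ : ℕ) : dyadicI (k + 1) (2 * ℓ) ⊆ dyadicI k ℓ := by
  have h : (0 : ℝ) < 2 ^ k := by positivity
  refine Set.Ico_subset_Ico ?_ ?_ <;> push_cast <;> rw [pow_succ] <;>
    rw [div_le_div_iff₀ (by positivity) (by positivity)] <;> nlinarith

theorem dyadicI_succ_right_subset (k ℓ : ℕ) : dyadicI (k + 1) (2 * ℓ + 1) ⊆ dyadicI k ℓ := by
  have h : (0 : ℝ) < 2 ^ k := by positivity
  refine Set.Ico_subset_Ico ?_ ?_ <;> push_cast <;> rw [pow_succ] <;>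
    rw [div_le_div_iff₀ (by positivity) (by positivity)] <;> nlinarith

theorem dyadicI_subset_unit {k ℓ : ℕ} (hℓ : ℓ < 2 ^ k) : dyadicI k ℓ ⊆ Set.Ico 0 1 := by
  refine Set.Ico_subset_Ico (by positivity) ?_
  rw [div_le_one (by positivity)]
  exact_mod_cast hℓ

theorem volume_real_dyadicI (k ℓ : ℕ) : volume.real (dyadicI k ℓ) = 1 / 2 ^ k := by
  have h : (ℓ : ℝ) / 2 ^ k ≤ ((ℓ : ℝ) + 1) / 2 ^ k := by gcongr; linarith
  rw [dyadicI, Real.volume_real_Ico_of_le h]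
  ring

theorem measurable_haarFn (k ℓ : ℕ) : Measurable (haarFn k ℓ) :=
  ((measurable_const.indicator (measurableSet_dyadicI _ _)).sub
    (measurable_const.indicator (measurableSet_dyadicI _ _))).const_mul _

theorem abs_haarFn_le (k ℓ : ℕ) (x : ℝ) :
    |haarFn k ℓ x| ≤ (dyadicI k ℓ).indicator (fun _ => (2 : ℝ) ^ ((k : ℝ) / 2)) x := by
  have hp : (0 : ℝ) ≤ 2 ^ ((k : ℝ) / 2) := by positivity
  by_cases hx : x ∈ dyadicI k ℓ
  · rw [Set.indicator_of_mem hx, haarFn, abs_mul, abs_of_nonneg hp]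
    refine mul_le_of_le_one_right hp ?_
    by_cases h₁ : x ∈ dyadicI (k + 1) (2 * ℓ) <;>
      by_cases h₂ : x ∈ dyadicI (k + 1) (2 * ℓ + 1) <;> simp [h₁, h₂]
  · rw [Set.indicator_of_notMem hx, haarFn,
      Set.indicator_of_notMem fun h => hx (dyadicI_succ_left_subset k ℓ h),
      Set.indicator_of_notMem fun h => hx (dyadicI_succ_right_subset k ℓ h)]
    simp

theorem abs_haarFn_le_const (k ℓ : ℕ) (x : ℝ) : |haarFn k ℓ x| ≤ (2 : ℝ) ^ ((k : ℝ) / 2) :=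
  (abs_haarFn_le k ℓ x).trans (Set.indicator_le_self' (fun _ _ => by positivity) x)

theorem setIntegral_haarFn {k ℓ : ℕ} (hℓ : ℓ < 2 ^ k) :
    ∫ x in Set.Ico (0 : ℝ) 1, haarFn k ℓ x = 0 := by
  have hint (j : ℕ) : Integrable ((dyadicI (k + 1) j).indicator fun _ => (1 : ℝ))
      (volume.restrict (Set.Ico (0 : ℝ) 1)) :=
    (integrable_const (1 : ℝ)).indicator (measurableSet_dyadicI _ _)
  have hval (j : ℕ) (hj : dyadicI (k + 1) j ⊆ dyadicI k ℓ) :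
      ∫ x in Set.Ico (0 : ℝ) 1, (dyadicI (k + 1) j).indicator (fun _ => (1 : ℝ)) x
        = 1 / 2 ^ (k + 1) := by
    rw [setIntegral_indicator (measurableSet_dyadicI _ _),
      Set.inter_eq_self_of_subset_right (hj.trans (dyadicI_subset_unit hℓ)),
      setIntegral_const, volume_real_dyadicI, smul_eq_mul, mul_one]
  simp only [haarFn]
  rw [integral_const_mul, integral_sub (hint _) (hint _),
    hval _ (dyadicI_succ_left_subset k ℓ), hval _ (dyadicI_succ_right_subset k ℓ),
    sub_self, mul_zero]

theorem integrable_mul_haarFn {g : ℝ → ℝ} {μ : Measure ℝ} (hg : Integrable g μ) (k ℓ : ℕ) :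
    Integrable (fun x => g x * haarFn k ℓ x) μ :=
  hg.mul_bdd (c := (2 : ℝ) ^ ((k : ℝ) / 2)) (measurable_haarFn k ℓ).aestronglyMeasurable
    (Filter.Eventually.of_forall fun x => abs_haarFn_le_const k ℓ x)

theorem integrable_sqrt {α : Type*} [MeasurableSpace α] {μ : Measure α} [IsFiniteMeasure μ]
    {f : α → ℝ} (hf : Integrable f μ) : Integrable (fun x => Real.sqrt (f x)) μ := by
  refine Integrable.mono' (hf.norm.add (integrable_const (1 : ℝ)))
    (Real.continuous_sqrt.comp_aestronglyMeasurable hf.aestronglyMeasurable)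
    (Filter.Eventually.of_forall fun x => ?_)
  simp only [Pi.add_apply, Real.norm_eq_abs, abs_of_nonneg (Real.sqrt_nonneg _)]
  refine Real.sqrt_le_iff.2 ⟨by positivity, ?_⟩
  nlinarith [le_abs_self (f x), abs_nonneg (f x)]

theorem Real.sq_sqrt_sub_sqrt_le {a c : ℝ} (ha : 0 ≤ a) (hc : 0 < c) :
    (√a - √c) ^ 2 ≤ (a - c) ^ 2 / c := by
  have h : (a - c) ^ 2 = (√a - √c) ^ 2 * (√a + √c) ^ 2 := by
    rw [← mul_pow]
    congr 1
    linear_combination -Real.sq_sqrt ha + Real.sq_sqrt hc.le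
  rw [le_div_iff₀ hc, h]
  refine mul_le_mul_of_nonneg_left ?_ (sq_nonneg _)
  nlinarith [Real.sq_sqrt hc.le, Real.sqrt_nonneg a, Real.sqrt_nonneg c,
    mul_nonneg (Real.sqrt_nonneg a) (Real.sqrt_nonneg c)]

theorem Real.rpow_neg_three_halves {c : ℝ} (hc : 0 < c) :
    c ^ (-(3 / 2) : ℝ) = 1 / (c * √c) := by
  rw [Real.rpow_neg hc.le, show (3 / 2 : ℝ) = 1 + 1 / 2 by norm_num, Real.rpow_add hc,
    Real.rpow_one, ← Real.sqrt_eq_rpow, one_div]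

theorem haarCoeff_sqrt_sub {f : ℝ → ℝ} (hf : IntegrableOn f (Set.Ico 0 1))
    (hf0 : ∀ x ∈ Set.Ico (0 : ℝ) 1, 0 ≤ f x) {k ℓ : ℕ} (hℓ : ℓ < 2 ^ k) {c : ℝ} (hc : 0 < c) :
    haarCoeff (fun x => √(f x)) k ℓ - haarCoeff f k ℓ / (2 * √c) =
      ∫ x in Set.Ico (0 : ℝ) 1, -((√(f x) - √c) ^ 2 / (2 * √c)) * haarFn k ℓ x := by
  have hs : 0 < √c := Real.sqrt_pos.2 hc
  have hsf : IntegrableOn (fun x => √(f x)) (Set.Ico 0 1) := integrable_sqrt hf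
  have hφ : IntegrableOn (fun x => √c / 2 * haarFn k ℓ x) (Set.Ico 0 1) :=
    integrable_mul_haarFn (integrable_const _) k ℓ
  have hzero : ∫ x in Set.Ico (0 : ℝ) 1, √c / 2 * haarFn k ℓ x = 0 := by
    rw [integral_const_mul, setIntegral_haarFn hℓ, mul_zero]
  have h₁ := integrable_mul_haarFn hsf k ℓ
  have h₂ := (integrable_mul_haarFn hf k ℓ).div_const (2 * √c)
  rw [haarCoeff, haarCoeff, ← integral_div, ← integral_sub h₁ h₂]
  refine (sub_zero _).symm.trans ?_
  refine (congrArg _ hzero.symm).trans ((integral_sub (h₁.sub h₂) hφ).symm.trans ?_)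
  refine setIntegral_congr_fun measurableSet_Ico fun x hx => ?_
  have h := Real.sq_sqrt (hf0 x hx)
  have h' := Real.sq_sqrt hc.le
  simp only [Pi.sub_apply]
  field_simp
  linear_combination (haarFn k ℓ x) * h

/-- For a nonnegative integrable `f` on `[0,1]` with `f_{k,ℓ} = 2^k ∫_{I_{k,ℓ}} f > 0`,
`|∫ √f φ_{k,ℓ} − θ_{k,ℓ}/(2√f_{k,ℓ})| ≤ 2^{k/2−1} f_{k,ℓ}^{−3/2} ∫_{I_{k,ℓ}} (f − f_{k,ℓ})²`. -/
theorem haar_coeff_sqrt_bound (f : ℝ → ℝ)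
    (hf : IntegrableOn f (Set.Icc 0 1)) (hf0 : ∀ x ∈ Set.Icc (0 : ℝ) 1, 0 ≤ f x)
    (k ℓ : ℕ) (hℓ : ℓ < 2 ^ k)
    (hpos : 0 < dyadicAvg f k ℓ) :
    ENNReal.ofReal
        |haarCoeff (fun x => Real.sqrt (f x)) k ℓ -
          haarCoeff f k ℓ / (2 * Real.sqrt (dyadicAvg f k ℓ))| ≤
      ENNReal.ofReal ((2 : ℝ) ^ ((k : ℝ) / 2) / 2 * dyadicAvg f k ℓ ^ (-(3 / 2) : ℝ)) *
        ∫⁻ x in dyadicI k ℓ, ENNReal.ofReal ((f x - dyadicAvg f k ℓ) ^ 2) := by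
  have hf' : IntegrableOn f (Set.Ico 0 1) := hf.mono_set Set.Ico_subset_Icc_self
  have hf0' : ∀ x ∈ Set.Ico (0 : ℝ) 1, 0 ≤ f x := fun x hx => hf0 x (Set.Ico_subset_Icc_self hx)
  rw [haarCoeff_sqrt_sub hf' hf0' hℓ hpos, ← Real.enorm_eq_ofReal_abs,
    Real.rpow_neg_three_halves hpos]
  set c := dyadicAvg f k ℓ
  have hs : 0 < √c := Real.sqrt_pos.2 hpos
  rw [← lintegral_const_mul' _ _ ENNReal.ofReal_ne_top]
  calc _ ≤ ∫⁻ x in Set.Ico (0 : ℝ) 1, ‖-((√(f x) - √c) ^ 2 / (2 * √c)) * haarFn k ℓ x‖ₑ :=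
        enorm_integral_le_lintegral_enorm _
    _ ≤ ∫⁻ x in Set.Ico (0 : ℝ) 1, (dyadicI k ℓ).indicator (fun x =>
          ENNReal.ofReal ((2 : ℝ) ^ ((k : ℝ) / 2) / 2 * (1 / (c * √c))) *
            ENNReal.ofReal ((f x - c) ^ 2)) x := by
        refine setLIntegral_mono' measurableSet_Ico fun x hx => ?_
        have hφ := abs_haarFn_le k ℓ x
        rw [Real.enorm_eq_ofReal_abs, abs_mul, abs_neg,
          abs_of_nonneg (by positivity : 0 ≤ (√(f x) - √c) ^ 2 / (2 * √c))]
        by_cases hxI : x ∈ dyadicI k ℓ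
        · rw [Set.indicator_of_mem hxI] at hφ ⊢
          rw [← ENNReal.ofReal_mul (by positivity)]
          refine ENNReal.ofReal_le_ofReal ?_
          calc _ ≤ (f x - c) ^ 2 / c / (2 * √c) * (2 : ℝ) ^ ((k : ℝ) / 2) := by
                gcongr
                exact Real.sq_sqrt_sub_sqrt_le (hf0' x hx) hpos
            _ = _ := by field_simp
        · rw [Set.indicator_of_notMem hxI] at hφ ⊢
          rw [le_antisymm hφ (abs_nonneg _), mul_zero, ENNReal.ofReal_zero]
    _ ≤ _ := by
        rw [lintegral_indicator (measurableSet_dyadicI k ℓ),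
          Measure.restrict_restrict (measurableSet_dyadicI k ℓ),
          Set.inter_eq_self_of_subset_left (dyadicI_subset_unit hℓ)]
end

section
/- Let X_λ be a Poisson random variable with mean λ > 0. Then E(√X_λ − √λ)⁴ ≤ 4. -/
lemma hasSum_poisson_one (lam : ℝ) :
    HasSum (fun j : ℕ => Real.exp (-lam) * lam ^ j / (Nat.factorial j)) 1 := by
  have h := (NormedSpace.expSeries_div_hasSum_exp (𝔸 := ℝ) lam).mul_left (Real.exp (-lam))
  rw [← Real.exp_eq_exp_ℝ, ← Real.exp_add, neg_add_cancel, Real.exp_zero] at h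
  simpa only [mul_div_assoc] using h

/-- The Stein–Chen identity `E[X f(X)] = λ E[f(X + 1)]` for a Poisson variable. -/
lemma hasSum_poisson_mul_of_shift {lam : ℝ} {f : ℕ → ℝ} {a : ℝ}
    (h : HasSum (fun j : ℕ => Real.exp (-lam) * lam ^ j / (Nat.factorial j) * f (j + 1)) a) :
    HasSum (fun j : ℕ => Real.exp (-lam) * lam ^ j / (Nat.factorial j) * (j * f j))
      (lam * a) := by
  rw [← hasSum_nat_add_iff' 1]
  convert h.mul_left lam using 1
  · rfl
  · funext j
    have h1 : (Nat.factorial j : ℝ) ≠ 0 := by positivity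
    have h2 : (j + 1 : ℝ) ≠ 0 := by positivity
    rw [Nat.factorial_succ]
    push_cast
    field_simp
    ring
  · simp

lemma hasSum_poisson_id (lam : ℝ) :
    HasSum (fun j : ℕ => Real.exp (-lam) * lam ^ j / (Nat.factorial j) * j) lam := by
  have h := hasSum_poisson_mul_of_shift (f := fun _ => 1) (lam := lam) (a := 1)
    (by simpa using hasSum_poisson_one lam)
  simpa using h

lemma hasSum_poisson_sq (lam : ℝ) :
    HasSum (fun j : ℕ => Real.exp (-lam) * lam ^ j / (Nat.factorial j) * (j : ℝ) ^ 2)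
      (lam ^ 2 + lam) := by
  have h := hasSum_poisson_mul_of_shift (f := fun j => (j : ℝ)) (lam := lam) (a := lam + 1) (by
    convert (hasSum_poisson_id lam).add (hasSum_poisson_one lam) using 1
    funext j; push_cast; ring)
  convert h using 1
  · funext j; ring
  · ring

lemma hasSum_poisson_cube (lam : ℝ) :
    HasSum (fun j : ℕ => Real.exp (-lam) * lam ^ j / (Nat.factorial j) * (j : ℝ) ^ 3)
      (lam ^ 3 + 3 * lam ^ 2 + lam) := by
  have h := hasSum_poisson_mul_of_shift (f := fun j => (j : ℝ) ^ 2) (lam := lam)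
    (a := (lam ^ 2 + lam) + 2 * lam + 1) (by
    convert ((hasSum_poisson_sq lam).add ((hasSum_poisson_id lam).mul_left 2)).add
      (hasSum_poisson_one lam) using 1
    funext j; push_cast; ring)
  convert h using 1
  · funext j; ring
  · ring

lemma hasSum_poisson_pow_four (lam : ℝ) :
    HasSum (fun j : ℕ => Real.exp (-lam) * lam ^ j / (Nat.factorial j) * (j : ℝ) ^ 4)
      (lam ^ 4 + 6 * lam ^ 3 + 7 * lam ^ 2 + lam) := by
  have h := hasSum_poisson_mul_of_shift (f := fun j => (j : ℝ) ^ 3) (lam := lam)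
    (a := (lam ^ 3 + 3 * lam ^ 2 + lam) + 3 * (lam ^ 2 + lam) + 3 * lam + 1) (by
    convert (((hasSum_poisson_cube lam).add ((hasSum_poisson_sq lam).mul_left 3)).add
      ((hasSum_poisson_id lam).mul_left 3)).add (hasSum_poisson_one lam) using 1
    funext j; push_cast; ring)
  convert h using 1
  · funext j; ring
  · ring

lemma hasSum_poisson_central_sq (lam : ℝ) :
    HasSum (fun j : ℕ => Real.exp (-lam) * lam ^ j / (Nat.factorial j) * ((j : ℝ) - lam) ^ 2)
      lam := by
  convert ((hasSum_poisson_sq lam).add ((hasSum_poisson_id lam).mul_left (-2 * lam))).add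
    ((hasSum_poisson_one lam).mul_left (lam ^ 2)) using 1
  · funext j; ring
  · ring

lemma hasSum_poisson_central_pow_four (lam : ℝ) :
    HasSum (fun j : ℕ => Real.exp (-lam) * lam ^ j / (Nat.factorial j) * ((j : ℝ) - lam) ^ 4)
      (3 * lam ^ 2 + lam) := by
  convert ((((hasSum_poisson_pow_four lam).add
    ((hasSum_poisson_cube lam).mul_left (-4 * lam))).add
    ((hasSum_poisson_sq lam).mul_left (6 * lam ^ 2))).add
    ((hasSum_poisson_id lam).mul_left (-4 * lam ^ 3))).add
    ((hasSum_poisson_one lam).mul_left (lam ^ 4)) using 1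
  · funext j; ring
  · ring

lemma sqrt_sub_sqrt_pow_four_le_sq {x y : ℝ} (hx : 0 ≤ x) (hy : 0 ≤ y) :
    (√x - √y) ^ 4 ≤ (x - y) ^ 2 := by
  have hs := Real.sqrt_nonneg x
  have ht := Real.sqrt_nonneg y
  have h : (x - y) ^ 2 = (√x - √y) ^ 2 * (√x + √y) ^ 2 := by
    rw [← mul_pow, mul_comm, ← sq_sub_sq, Real.sq_sqrt hx, Real.sq_sqrt hy]
  rw [h, show (√x - √y) ^ 4 = (√x - √y) ^ 2 * (√x - √y) ^ 2 by ring]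
  gcongr ?_ * ?_
  nlinarith [mul_nonneg hs ht]

lemma sqrt_sub_sqrt_pow_four_le_div {x y : ℝ} (hx : 0 ≤ x) (hy : 0 < y) :
    (√x - √y) ^ 4 ≤ (x - y) ^ 4 / y ^ 2 := by
  have hs := Real.sqrt_nonneg x
  have h : (x - y) ^ 4 = (√x - √y) ^ 4 * (√x + √y) ^ 4 := by
    rw [← mul_pow, mul_comm (√x - √y), ← sq_sub_sq, Real.sq_sqrt hx, Real.sq_sqrt hy.le]
  have h2 : y ^ 2 ≤ (√x + √y) ^ 4 := by
    calc y ^ 2 = (√y) ^ 4 := by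
          rw [show (√y) ^ 4 = ((√y) ^ 2) ^ 2 by ring, Real.sq_sqrt hy.le]
      _ ≤ (√x + √y) ^ 4 := by gcongr; linarith
  rw [le_div_iff₀ (by positivity), h]
  gcongr

/-- A nonnegative function dominated by one with a known sum has `ℝ≥0∞`-valued sum at most that
sum. -/
lemma tsum_ofReal_le_of_hasSum {f g : ℕ → ℝ} {a : ℝ} (hf : ∀ j, 0 ≤ f j)
    (hfg : ∀ j, f j ≤ g j) (hg : HasSum g a) :
    ∑' j, ENNReal.ofReal (f j) ≤ ENNReal.ofReal a := by
  rw [← hg.tsum_eq, ENNReal.ofReal_tsum_of_nonneg (fun j => (hf j).trans (hfg j)) hg.summable]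
  exact ENNReal.tsum_le_tsum fun j => ENNReal.ofReal_le_ofReal (hfg j)

/-- For `X_λ ~ Poisson(λ)` with `λ > 0`, `E(√X_λ − √λ)⁴ ≤ 4`. -/
theorem poisson_sqrt_fourth_moment (lam : ℝ) (hlam : 0 < lam) :
    ∑' j : ℕ,
        ENNReal.ofReal
          (Real.exp (-lam) * lam ^ j / (Nat.factorial j) *
            (Real.sqrt j - Real.sqrt lam) ^ 4) ≤ 4 := by
  have hnonneg (j : ℕ) : 0 ≤ Real.exp (-lam) * lam ^ j / (Nat.factorial j) *
      (Real.sqrt j - Real.sqrt lam) ^ 4 := by positivity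
  suffices ∃ a ≤ (4 : ℝ), ∑' j : ℕ, ENNReal.ofReal (Real.exp (-lam) * lam ^ j /
      (Nat.factorial j) * (Real.sqrt j - Real.sqrt lam) ^ 4) ≤ ENNReal.ofReal a by
    obtain ⟨a, ha, h⟩ := this
    refine h.trans ((ENNReal.ofReal_le_ofReal ha).trans_eq ?_)
    simp
  rcases le_total lam 1 with h1 | h1
  · refine ⟨lam, by linarith, tsum_ofReal_le_of_hasSum hnonneg (fun j => ?_)
      (hasSum_poisson_central_sq lam)⟩
    gcongr
    exact sqrt_sub_sqrt_pow_four_le_sq j.cast_nonneg hlam.le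
  · refine ⟨(3 * lam ^ 2 + lam) / lam ^ 2, ?_, tsum_ofReal_le_of_hasSum hnonneg (fun j => ?_)
      ((hasSum_poisson_central_pow_four lam).div_const (lam ^ 2))⟩
    · rw [div_le_iff₀ (by positivity)]
      nlinarith
    · have hw : 0 ≤ Real.exp (-lam) * lam ^ j / (Nat.factorial j) := by positivity
      simpa only [mul_div_assoc] using
        mul_le_mul_of_nonneg_left (sqrt_sub_sqrt_pow_four_le_div j.cast_nonneg hlam) hw
end
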